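/- Let n ≥ 2 and let C be a Borel subset of the unit sphere S^{n−1} ⊆ ℝⁿ with μ₁(C) ∈ [β, 1/2] for some 0 < β ≤ 1/2. Let y⁽¹⁾, y⁽²⁾ be two independent uniformly random points of S^{n−1} and let V = span{y⁽¹⁾, y⁽²⁾} (which is almost surely a 2-dimensional subspace). Then Pr[μ_{V,1}(C ∩ V) ∈ [β/4, 9/10]] ≥ β/2. Similarly, if μ₁(C) ∈ [1/2, 1−β], then Pr[μ_{V,1}(C ∩ V) ∈ [1/10, 1 − β/4]] ≥ β/2. -/

import Mathlib

open MeasureTheory ProbabilityTheory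

/-- The standard Gaussian measure `N(0,1)ⁿ` on `ℝⁿ`. -/
noncomputable def stdGaussian (n : ℕ) : Measure (EuclideanSpace ℝ (Fin n)) :=
  (Measure.pi fun _ : Fin n => gaussianReal 0 1).map
    (EuclideanSpace.equiv (Fin n) ℝ).symm

/-- The uniform (rotation-invariant) probability measure on the origin-centered sphere of
radius `r` in `ℝⁿ`. -/
noncomputable def sphereUniform (n : ℕ) (r : ℝ) : Measure (EuclideanSpace ℝ (Fin n)) :=
  (stdGaussian n).map (fun x => (r / ‖x‖) • x)

open Classical in
/-- `μ_{V,r}(A)`: the measure of `A` as a fraction of the circle `V ∩ {‖x‖ = r}`,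
for a 2-dimensional subspace `V` of `ℝⁿ`, defined by pushing forward the uniform
probability measure on the radius-`r` circle in `ℝ²` through a linear isometry
with range `V`.  (The value does not depend on the choice of isometry, since the
circle measure is rotation invariant.) -/
noncomputable def subspaceCircleFrac (n : ℕ) (V : Submodule ℝ (EuclideanSpace ℝ (Fin n)))
    (r : ℝ) (A : Set (EuclideanSpace ℝ (Fin n))) : ℝ :=
  if h : ∃ φ : EuclideanSpace ℝ (Fin 2) →ₗᵢ[ℝ] EuclideanSpace ℝ (Fin n),
      LinearMap.range φ.toLinearMap = V then
    (((sphereUniform 2 r).map h.choose) A).toReal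
  else 0

open scoped RealInnerProductSpace ENNReal

lemma stdGaussian_eq_probabilityTheory_stdGaussian (n : ℕ) :
    _root_.stdGaussian n = ProbabilityTheory.stdGaussian (EuclideanSpace ℝ (Fin n)) :=
  map_pi_eq_stdGaussian

instance isProbabilityMeasure_sphereUniform_one (n : ℕ) :
    IsProbabilityMeasure (sphereUniform n 1) := by
  unfold sphereUniform
  rw [stdGaussian_eq_probabilityTheory_stdGaussian]
  exact Measure.isProbabilityMeasure_map (by fun_prop)

/-- Linear isometries preserve the uniform measure on the sphere. -/
lemma sphereUniform_map_linearIsometryEquiv (n : ℕ) (r : ℝ)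
    (f : EuclideanSpace ℝ (Fin n) ≃ₗᵢ[ℝ] EuclideanSpace ℝ (Fin n)) :
    (sphereUniform n r).map f = sphereUniform n r := by
  have hf : Measurable f := f.continuous.measurable
  unfold sphereUniform
  rw [stdGaussian_eq_probabilityTheory_stdGaussian, Measure.map_map hf (by fun_prop)]
  conv_rhs => rw [← stdGaussian_map f, Measure.map_map (by fun_prop) hf]
  congr 1
  ext1 x
  simp

lemma stdGaussian_hyperplane_eq_zero {n : ℕ} {u : EuclideanSpace ℝ (Fin n)} (hu : u ≠ 0) :
    _root_.stdGaussian n {g | ⟪u, g⟫ = 0} = 0 := by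
  rw [stdGaussian_eq_probabilityTheory_stdGaussian]
  set γ := ProbabilityTheory.stdGaussian (EuclideanSpace ℝ (Fin n))
  have h := IsGaussian.map_eq_gaussianReal (μ := γ) (innerSL ℝ u)
  have hv : Var[innerSL ℝ u; γ] = ‖u‖ ^ 2 := by
    rw [variance_dual_stdGaussian, innerSL_apply_norm]
  have hne : (Var[innerSL ℝ u; γ]).toNNReal ≠ 0 := by
    rw [hv, Ne, Real.toNNReal_eq_zero, not_le]
    positivity
  have := nullSingletonClass_gaussianReal (μ := γ[innerSL ℝ u]) hne
  have h0 : γ.map (innerSL ℝ u) {0} = 0 := by rw [h]; exact measure_singleton 0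
  rwa [Measure.map_apply (by fun_prop) (measurableSet_singleton 0)] at h0

lemma ae_norm_eq_one_sphereUniform {n : ℕ} (hn : 1 ≤ n) :
    ∀ᵐ x ∂(sphereUniform n 1), ‖x‖ = 1 := by
  have : Nonempty (Fin n) := ⟨⟨0, hn⟩⟩
  obtain ⟨u, hu⟩ := exists_ne (0 : EuclideanSpace ℝ (Fin n))
  have hm : MeasurableSet {x : EuclideanSpace ℝ (Fin n) | ‖x‖ = 1} :=
    measurableSet_eq_fun (by fun_prop) (by fun_prop)
  unfold sphereUniform
  rw [ae_map_iff (by fun_prop) hm]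
  have h0 : ∀ᵐ g ∂(_root_.stdGaussian n), ⟪u, g⟫ ≠ 0 := by
    rw [ae_iff]; simpa using stdGaussian_hyperplane_eq_zero hu
  filter_upwards [h0] with g hg
  have : g ≠ 0 := by rintro rfl; simp at hg
  have : ‖g‖ ≠ 0 := by simpa using this
  simp [norm_smul, this]

lemma ae_notMem_span_sphereUniform {n : ℕ} (hn : 2 ≤ n) (x : EuclideanSpace ℝ (Fin n)) :
    ∀ᵐ y ∂(sphereUniform n 1), y ∉ Submodule.span ℝ {x} := by
  have hlt : Submodule.span ℝ {x} ≠ ⊤ := by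
    intro h
    have h1 := finrank_span_le_card (R := ℝ) {x}
    rw [h, finrank_top, finrank_euclideanSpace_fin] at h1
    simp at h1
    omega
  have hbot : (Submodule.span ℝ {x})ᗮ ≠ ⊥ := by
    rwa [Ne, Submodule.orthogonal_eq_bot_iff]
  obtain ⟨u, huS, hu⟩ := Submodule.exists_mem_ne_zero_of_ne_bot hbot
  have h0 : ∀ᵐ g ∂(_root_.stdGaussian n), ⟪u, g⟫ ≠ 0 := by
    rw [ae_iff]; simpa using stdGaussian_hyperplane_eq_zero hu
  unfold sphereUniform
  have hm : MeasurableSet {y | y ∉ Submodule.span ℝ {x}} :=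
    (Submodule.closed_of_finiteDimensional _).measurableSet.compl
  rw [ae_map_iff (by fun_prop) hm]
  filter_upwards [h0] with g hg hmem
  have hg0 : ‖g‖ ≠ 0 := by
    intro h; rw [norm_eq_zero] at h; simp [h] at hg
  have h1 := Submodule.inner_left_of_mem_orthogonal hmem huS
  rw [inner_smul_right] at h1
  simp_all

lemma exists_isMulRightInvariant_unitary (n : ℕ) :
    ∃ ν : Measure (unitary (EuclideanSpace ℝ (Fin n) →L[ℝ] EuclideanSpace ℝ (Fin n))),
      IsProbabilityMeasure ν ∧ ν.IsMulRightInvariant := by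
  let A := EuclideanSpace ℝ (Fin n) →L[ℝ] EuclideanSpace ℝ (Fin n)
  have : ContinuousStar A := ⟨ContinuousLinearMap.adjoint.continuous⟩
  have : ProperSpace A := FiniteDimensional.proper ℝ A
  have : CompactSpace (unitary A) := by
    refine isCompact_iff_compactSpace.mp (Metric.isCompact_of_isClosed_isBounded
      isClosed_unitary ?_)
    refine (Metric.isBounded_closedBall (x := (0 : A)) (r := 1)).subset fun U hU => ?_
    rw [mem_closedBall_zero_iff]
    refine ContinuousLinearMap.opNorm_le_bound _ zero_le_one fun x => ?_
    rw [ContinuousLinearMap.norm_map_of_mem_unitary hU, one_mul]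
  have : BorelSpace (unitary A) := Subtype.borelSpace _
  let K : TopologicalSpace.PositiveCompacts (unitary A) := ⊤
  have hK : IsProbabilityMeasure (Measure.haarMeasure K) :=
    ⟨by simpa [K] using Measure.haarMeasure_self (K₀ := K)⟩
  refine ⟨(Measure.haarMeasure K).inv, ?_, inferInstance⟩
  exact ⟨by simp⟩
section Frame

variable {E : Type*} [NormedAddCommGroup E] [InnerProductSpace ℝ E]

lemma LinearIsometry.exists_linearIsometryEquiv_comp_eq {F : Type*} [NormedAddCommGroup F]
    [InnerProductSpace ℝ F] [FiniteDimensional ℝ E] (φ ψ : F →ₗᵢ[ℝ] E) :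
    ∃ R : E ≃ₗᵢ[ℝ] E, ∀ x, R (φ x) = ψ x := by
  let L : LinearMap.range φ.toLinearMap →ₗᵢ[ℝ] E :=
    ψ.comp φ.equivRange.symm.toLinearIsometry
  refine ⟨L.extend.toLinearIsometryEquiv rfl, fun x => ?_⟩
  have h := L.extend_apply (φ.equivRange x)
  simpa [L] using h

/-- Multiplication in `ℝ² = ℂ`. -/
noncomputable def planeMul (v w : EuclideanSpace ℝ (Fin 2)) : EuclideanSpace ℝ (Fin 2) :=
  !₂[v 0 * w 0 - v 1 * w 1, v 1 * w 0 + v 0 * w 1]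

lemma planeMul_comm (v w : EuclideanSpace ℝ (Fin 2)) : planeMul v w = planeMul w v := by
  ext i; fin_cases i <;> simp [planeMul] <;> ring

lemma norm_planeMul (v w : EuclideanSpace ℝ (Fin 2)) : ‖planeMul v w‖ = ‖v‖ * ‖w‖ := by
  rw [← sq_eq_sq₀ (norm_nonneg _) (by positivity), mul_pow]
  simp only [EuclideanSpace.real_norm_sq_eq, Fin.sum_univ_two, planeMul]
  simp
  ring

/-- Multiplication by a unit vector of `ℝ² = ℂ`, as a rotation. -/
noncomputable def planeRotation (v : EuclideanSpace ℝ (Fin 2)) (hv : ‖v‖ = 1) :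
    EuclideanSpace ℝ (Fin 2) ≃ₗᵢ[ℝ] EuclideanSpace ℝ (Fin 2) :=
  LinearIsometry.toLinearIsometryEquiv
    { toFun := planeMul v
      map_add' := fun x y => by ext i; fin_cases i <;> simp [planeMul] <;> ring
      map_smul' := fun c x => by ext i; fin_cases i <;> simp [planeMul] <;> ring
      norm_map' := fun x => by simp [norm_planeMul, hv] } rfl

@[simp]
lemma planeRotation_apply (v : EuclideanSpace ℝ (Fin 2)) (hv : ‖v‖ = 1)
    (w : EuclideanSpace ℝ (Fin 2)) : planeRotation v hv w = planeMul v w := rfl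

/-- The second vector of the Gram-Schmidt orthonormalization of `(p.1, p.2)`, for a unit vector
`p.1`. -/
noncomputable def frameSnd (p : E × E) : E :=
  ‖p.2 - ⟪p.1, p.2⟫ • p.1‖⁻¹ • (p.2 - ⟪p.1, p.2⟫ • p.1)

/-- The linear map from `ℝ²` to the span of `p.1` and `p.2` given by Gram-Schmidt
orthonormalization. -/
noncomputable def frameMap (p : E × E) (w : EuclideanSpace ℝ (Fin 2)) : E :=
  w 0 • p.1 + w 1 • frameSnd p

/-- The coordinates of `p.2` in the Gram-Schmidt frame of `p`. -/
noncomputable def frameCoord (p : E × E) : EuclideanSpace ℝ (Fin 2) :=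
  !₂[⟪p.1, p.2⟫, ‖p.2 - ⟪p.1, p.2⟫ • p.1‖]

lemma frameMap_basis (p : E × E) : frameMap p !₂[1, 0] = p.1 := by simp [frameMap]

lemma frameMap_frameCoord (p : E × E) : frameMap p (frameCoord p) = p.2 := by
  by_cases h : ‖p.2 - ⟪p.1, p.2⟫ • p.1‖ = 0
  · have h' := norm_eq_zero.mp h
    simpa [frameMap, frameCoord, h'] using (sub_eq_zero.mp h').symm
  · simp [frameMap, frameCoord, frameSnd, smul_smul, h]

lemma frameMap_map (U : E →ₗᵢ[ℝ] E) (p : E × E) (w : EuclideanSpace ℝ (Fin 2)) :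
    frameMap (U p.1, U p.2) w = U (frameMap p w) := by
  simp only [frameMap, frameSnd, LinearIsometry.inner_map_map, ← map_smul, ← map_sub, ← map_add,
    LinearIsometry.norm_map]

lemma frameCoord_map (U : E →ₗᵢ[ℝ] E) (p : E × E) :
    frameCoord (U p.1, U p.2) = frameCoord p := by
  simp only [frameCoord, LinearIsometry.inner_map_map, ← map_smul, ← map_sub,
    LinearIsometry.norm_map]

/-- Pairs consisting of two linearly independent unit vectors. -/
def IsUnitPair (p : E × E) : Prop := ‖p.1‖ = 1 ∧ ‖p.2‖ = 1 ∧ p.2 ∉ Submodule.span ℝ {p.1}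

lemma IsUnitPair.sub_ne_zero {p : E × E} (hp : IsUnitPair p) :
    p.2 - ⟪p.1, p.2⟫ • p.1 ≠ 0 := fun h =>
  hp.2.2 (Submodule.mem_span_singleton.mpr ⟨_, (sub_eq_zero.mp h).symm⟩)

lemma IsUnitPair.norm_frameSnd {p : E × E} (hp : IsUnitPair p) : ‖frameSnd p‖ = 1 := by
  rw [frameSnd, norm_smul, norm_inv, norm_norm,
    inv_mul_cancel₀ (norm_ne_zero_iff.mpr hp.sub_ne_zero)]

lemma IsUnitPair.inner_frameSnd {p : E × E} (hp : IsUnitPair p) : ⟪p.1, frameSnd p⟫ = 0 := by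
  rw [frameSnd, inner_smul_right, inner_sub_right, inner_smul_right,
    real_inner_self_eq_norm_sq, hp.1]
  simp

lemma IsUnitPair.norm_frameMap {p : E × E} (hp : IsUnitPair p) (w : EuclideanSpace ℝ (Fin 2)) :
    ‖frameMap p w‖ = ‖w‖ := by
  rw [← sq_eq_sq₀ (norm_nonneg _) (norm_nonneg _), frameMap, norm_add_sq_real, norm_smul,
    norm_smul, inner_smul_left, inner_smul_right, hp.inner_frameSnd, hp.norm_frameSnd, hp.1,
    EuclideanSpace.real_norm_sq_eq, Fin.sum_univ_two]
  simp

/-- The map `frameMap p` as a linear isometry. -/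
noncomputable def IsUnitPair.isometry {p : E × E} (hp : IsUnitPair p) :
    EuclideanSpace ℝ (Fin 2) →ₗᵢ[ℝ] E where
  toFun := frameMap p
  map_add' x y := by simp only [frameMap, PiLp.add_apply, add_smul]; abel
  map_smul' c x := by simp [frameMap, mul_smul]
  norm_map' := hp.norm_frameMap

@[simp]
lemma IsUnitPair.isometry_apply {p : E × E} (hp : IsUnitPair p) (w : EuclideanSpace ℝ (Fin 2)) :
    hp.isometry w = frameMap p w := rfl

lemma IsUnitPair.norm_frameCoord {p : E × E} (hp : IsUnitPair p) : ‖frameCoord p‖ = 1 := by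
  rw [← hp.norm_frameMap, frameMap_frameCoord, hp.2.1]

lemma IsUnitPair.range_isometry {p : E × E} (hp : IsUnitPair p) :
    LinearMap.range hp.isometry.toLinearMap = Submodule.span ℝ {p.1, p.2} := by
  apply le_antisymm
  · rintro _ ⟨w, rfl⟩
    have h1 : p.1 ∈ Submodule.span ℝ {p.1, p.2} := Submodule.subset_span (by simp)
    have h2 : p.2 ∈ Submodule.span ℝ {p.1, p.2} := Submodule.subset_span (by simp)
    exact Submodule.add_mem _ (Submodule.smul_mem _ _ h1) (Submodule.smul_mem _ _
      (Submodule.smul_mem _ _ (Submodule.sub_mem _ h2 (Submodule.smul_mem _ _ h1))))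
  · rw [Submodule.span_le]
    rintro z (rfl | rfl)
    · exact ⟨!₂[1, 0], frameMap_basis p⟩
    · exact ⟨frameCoord p, frameMap_frameCoord p⟩

/-- Rotate both vectors of `p` inside their span, moving `p.1` to the vector with coordinates `w`
in the Gram-Schmidt frame of `p`. -/
noncomputable def rotatePair (w : EuclideanSpace ℝ (Fin 2)) (p : E × E) : E × E :=
  (frameMap p w, frameMap p (planeMul (frameCoord p) w))

lemma rotatePair_map (U : E →ₗᵢ[ℝ] E) (w : EuclideanSpace ℝ (Fin 2)) (p : E × E) :
    rotatePair w (U p.1, U p.2) = (U (rotatePair w p).1, U (rotatePair w p).2) := by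
  simp only [rotatePair, frameMap_map, frameCoord_map]

lemma IsUnitPair.exists_linearIsometryEquiv_rotatePair [FiniteDimensional ℝ E] {p : E × E}
    (hp : IsUnitPair p) {w : EuclideanSpace ℝ (Fin 2)} (hw : ‖w‖ = 1) :
    ∃ R : E ≃ₗᵢ[ℝ] E, rotatePair w p = (R p.1, R p.2) := by
  obtain ⟨R, hR⟩ := LinearIsometry.exists_linearIsometryEquiv_comp_eq hp.isometry
    (hp.isometry.comp (planeRotation w hw).toLinearIsometry)
  simp only [isometry_apply, LinearIsometry.coe_comp, LinearIsometryEquiv.coe_toLinearIsometry,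
    Function.comp_apply, planeRotation_apply] at hR
  refine ⟨R, ?_⟩
  have h1 := hR !₂[1, 0]
  have h2 := hR (frameCoord p)
  rw [frameMap_basis] at h1
  rw [frameMap_frameCoord] at h2
  have h3 : planeMul w !₂[1, 0] = w := by ext i; fin_cases i <;> simp [planeMul]
  rw [rotatePair, h1, h2, h3, planeMul_comm]

variable [MeasurableSpace E] [BorelSpace E] [SecondCountableTopology E]

@[fun_prop]
lemma measurable_frameMap :
    Measurable fun q : (E × E) × EuclideanSpace ℝ (Fin 2) => frameMap q.1 q.2 := by
  unfold frameMap frameSnd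
  fun_prop

@[fun_prop]
lemma measurable_frameCoord : Measurable (frameCoord : E × E → _) := by
  unfold frameCoord
  fun_prop

@[fun_prop]
lemma measurable_planeMul :
    Measurable fun q : EuclideanSpace ℝ (Fin 2) × EuclideanSpace ℝ (Fin 2) =>
      planeMul q.1 q.2 := by
  refine (PiLp.continuous_toLp 2 _).measurable.comp (measurable_pi_iff.mpr fun i => ?_)
  fin_cases i <;> simp <;> fun_prop

lemma measurable_rotatePair :
    Measurable fun q : EuclideanSpace ℝ (Fin 2) × (E × E) => rotatePair q.1 q.2 := by
  have h : Measurable fun q : EuclideanSpace ℝ (Fin 2) × (E × E) =>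
      planeMul (frameCoord q.2) q.1 :=
    measurable_planeMul.comp ((measurable_frameCoord.comp measurable_snd).prodMk measurable_fst)
  exact (measurable_frameMap.comp measurable_swap).prodMk
    (measurable_frameMap.comp (measurable_snd.prodMk h))

end Frame
section Invariance

variable {n : ℕ}

/-- The law of two independent uniform points of the unit sphere is the average of the laws of the
images of a fixed pair under a random orthogonal map. -/
lemma sphereUniform_prod_apply_eq_lintegral_unitary
    (ν : Measure (unitary (EuclideanSpace ℝ (Fin n) →L[ℝ] EuclideanSpace ℝ (Fin n))))
    [IsProbabilityMeasure ν] {D : Set (EuclideanSpace ℝ (Fin n) × EuclideanSpace ℝ (Fin n))}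
    (hD : MeasurableSet D) :
    ((sphereUniform n 1).prod (sphereUniform n 1)) D =
      ∫⁻ p, ν {U | (U.1 p.1, U.1 p.2) ∈ D} ∂(sphereUniform n 1).prod (sphereUniform n 1) := by
  let E := EuclideanSpace ℝ (Fin n)
  let P := (sphereUniform n 1).prod (sphereUniform n 1)
  have hmeas : Measurable fun q : unitary (E →L[ℝ] E) × (E × E) =>
      (q.1.1 q.2.1, q.1.1 q.2.2) := by
    have h1 : Measurable fun q : unitary (E →L[ℝ] E) × (E × E) => q.1.1 :=
      measurable_subtype_coe.comp measurable_fst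
    have ha : Measurable fun q : (E →L[ℝ] E) × E => q.1 q.2 :=
      isBoundedBilinearMap_apply.continuous.measurable
    exact (ha.comp (h1.prodMk (measurable_fst.comp measurable_snd))).prodMk
      (ha.comp (h1.prodMk (measurable_snd.comp measurable_snd)))
  have hS := hmeas hD
  have hinv (U : unitary (E →L[ℝ] E)) : P ((fun p => (U.1 p.1, U.1 p.2)) ⁻¹' D) = P D := by
    have hU : (sphereUniform n 1).map U.1 = sphereUniform n 1 :=
      sphereUniform_map_linearIsometryEquiv n 1 (Unitary.linearIsometryEquiv U)
    have hUm : Measurable U.1 := U.1.continuous.measurable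
    have h := Measure.map_prod_map (sphereUniform n 1) (sphereUniform n 1) hUm hUm
    rw [hU] at h
    conv_rhs => rw [show P = _ from h, Measure.map_apply (hUm.prodMap hUm) hD]
    rfl
  calc P D = ∫⁻ U, P ((fun p => (U.1 p.1, U.1 p.2)) ⁻¹' D) ∂ν := by simp [hinv]
    _ = (ν.prod P) ((fun q => (q.1.1 q.2.1, q.1.1 q.2.2)) ⁻¹' D) := by
      rw [Measure.prod_apply hS]; rfl
    _ = _ := by rw [Measure.prod_apply_symm hS]; rfl

lemma ae_isUnitPair (hn : 2 ≤ n) :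
    ∀ᵐ p ∂(sphereUniform n 1).prod (sphereUniform n 1), IsUnitPair p := by
  let E := EuclideanSpace ℝ (Fin n)
  have h1 := ae_norm_eq_one_sphereUniform (n := n) (by omega)
  have ha : ∀ᵐ p ∂(sphereUniform n 1).prod (sphereUniform n 1), ‖p.1‖ = 1 :=
    Measure.quasiMeasurePreserving_fst.ae h1
  have hb : ∀ᵐ p ∂(sphereUniform n 1).prod (sphereUniform n 1), ‖p.2‖ = 1 :=
    Measure.quasiMeasurePreserving_snd.ae h1
  have hset : MeasurableSet {p : E × E | p.2 - ⟪p.1, p.2⟫ • p.1 ≠ 0} :=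
    (measurableSet_eq_fun (by fun_prop) (by fun_prop)).compl
  have hc : ∀ᵐ p ∂(sphereUniform n 1).prod (sphereUniform n 1),
      p.2 - ⟪p.1, p.2⟫ • p.1 ≠ 0 := by
    rw [Measure.ae_prod_iff_ae_ae hset]
    refine ae_of_all _ fun x => ?_
    filter_upwards [ae_notMem_span_sphereUniform hn x] with y hy h
    exact hy (Submodule.mem_span_singleton.mpr ⟨_, (sub_eq_zero.mp h).symm⟩)
  filter_upwards [ha, hb, hc] with p hpa hpb hpc
  refine ⟨hpa, hpb, fun hmem => hpc ?_⟩
  obtain ⟨c, hc⟩ := Submodule.mem_span_singleton.mp hmem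
  rw [← hc, inner_smul_right, real_inner_self_eq_norm_sq, hpa]
  simp

/-- The law of two independent uniform points of the unit sphere is invariant under rotations of
the plane they span. -/
lemma sphereUniform_prod_preimage_rotatePair (hn : 2 ≤ n) {w : EuclideanSpace ℝ (Fin 2)}
    (hw : ‖w‖ = 1) {D : Set (EuclideanSpace ℝ (Fin n) × EuclideanSpace ℝ (Fin n))}
    (hD : MeasurableSet D) :
    ((sphereUniform n 1).prod (sphereUniform n 1)) (rotatePair w ⁻¹' D) =
      ((sphereUniform n 1).prod (sphereUniform n 1)) D := by
  obtain ⟨ν, hν, hνr⟩ := exists_isMulRightInvariant_unitary n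
  have hT : Measurable (rotatePair w : EuclideanSpace ℝ (Fin n) × EuclideanSpace ℝ (Fin n) → _) :=
    measurable_rotatePair.comp measurable_prodMk_left
  rw [sphereUniform_prod_apply_eq_lintegral_unitary ν (hT hD),
    sphereUniform_prod_apply_eq_lintegral_unitary ν hD]
  refine lintegral_congr_ae ?_
  filter_upwards [ae_isUnitPair hn] with p hp
  obtain ⟨R, hR⟩ := hp.exists_linearIsometryEquiv_rotatePair hw
  conv_rhs => rw [← measure_preimage_mul_right ν (Unitary.linearIsometryEquiv.symm R)]
  congr 1
  ext U
  have h := rotatePair_map (Unitary.linearIsometryEquiv U).toLinearIsometry w p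
  simp only [Set.mem_ofPred_eq, Set.mem_preimage]
  have h' : rotatePair w (U.1 p.1, U.1 p.2) = (U.1 (R p.1), U.1 (R p.2)) := by
    rw [hR] at h; exact h
  rw [h']
  rfl

lemma sphereUniform_prod_apply_eq_lintegral_rotatePair (hn : 2 ≤ n)
    {D : Set (EuclideanSpace ℝ (Fin n) × EuclideanSpace ℝ (Fin n))} (hD : MeasurableSet D) :
    ((sphereUniform n 1).prod (sphereUniform n 1)) D =
      ∫⁻ p, sphereUniform 2 1 {w | rotatePair w p ∈ D}
        ∂(sphereUniform n 1).prod (sphereUniform n 1) := by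
  set P := (sphereUniform n 1).prod (sphereUniform n 1)
  have hS := measurable_rotatePair (E := EuclideanSpace ℝ (Fin n)) hD
  have hae : ∀ᵐ w ∂(sphereUniform 2 1), P (rotatePair w ⁻¹' D) = P D := by
    filter_upwards [ae_norm_eq_one_sphereUniform (n := 2) (by norm_num)] with w hw
    exact sphereUniform_prod_preimage_rotatePair hn hw hD
  calc P D = ∫⁻ w, P (rotatePair w ⁻¹' D) ∂(sphereUniform 2 1) := by
        rw [lintegral_congr_ae hae]; simp
    _ = ((sphereUniform 2 1).prod P) ((fun q => rotatePair q.1 q.2) ⁻¹' D) := by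
      rw [Measure.prod_apply hS]; rfl
    _ = _ := by rw [Measure.prod_apply_symm hS]; rfl

/-- The fraction of the unit circle in the span of `p` that lies in `C`, computed in the
Gram-Schmidt frame of `p`. -/
noncomputable def frameCircleFrac (C : Set (EuclideanSpace ℝ (Fin n)))
    (p : EuclideanSpace ℝ (Fin n) × EuclideanSpace ℝ (Fin n)) : ℝ :=
  (sphereUniform 2 1).real (frameMap p ⁻¹' C)

variable {C : Set (EuclideanSpace ℝ (Fin n))}

lemma measurable_frameMap_right
    (p : EuclideanSpace ℝ (Fin n) × EuclideanSpace ℝ (Fin n)) : Measurable (frameMap p) :=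
  measurable_frameMap.comp measurable_prodMk_left

lemma measurable_frameCircleFrac (hC : MeasurableSet C) : Measurable (frameCircleFrac C) :=
  (measurable_measure_prodMk_left (measurable_frameMap hC)).ennreal_toReal

lemma frameCircleFrac_compl (hC : MeasurableSet C)
    (p : EuclideanSpace ℝ (Fin n) × EuclideanSpace ℝ (Fin n)) :
    frameCircleFrac Cᶜ p = 1 - frameCircleFrac C p := by
  rw [frameCircleFrac, Set.preimage_compl,
    probReal_compl_eq_one_sub (measurable_frameMap_right p hC), frameCircleFrac]

lemma integral_frameCircleFrac (hn : 2 ≤ n) (hC : MeasurableSet C) :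
    ∫ p, frameCircleFrac C p ∂(sphereUniform n 1).prod (sphereUniform n 1) =
      (sphereUniform n 1).real C := by
  have h := sphereUniform_prod_apply_eq_lintegral_rotatePair hn (hC.prod MeasurableSet.univ)
  rw [Measure.prod_prod, measure_univ, mul_one] at h
  unfold frameCircleFrac Measure.real
  have hm : Measurable fun p : EuclideanSpace ℝ (Fin n) × EuclideanSpace ℝ (Fin n) =>
      sphereUniform 2 1 (frameMap p ⁻¹' C) :=
    measurable_measure_prodMk_left (measurable_frameMap hC)
  rw [h, integral_toReal hm.aemeasurable (ae_of_all _ fun p => measure_lt_top _ _)]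
  simp [rotatePair, Set.preimage]

lemma real_mul_one_sub_le_integral_min (hn : 2 ≤ n) (hC : MeasurableSet C) :
    (sphereUniform n 1).real C * (1 - (sphereUniform n 1).real C) ≤
      ∫ p, min (frameCircleFrac C p) (1 - frameCircleFrac C p)
        ∂(sphereUniform n 1).prod (sphereUniform n 1) := by
  set P := (sphereUniform n 1).prod (sphereUniform n 1)
  have hD := hC.prod hC.compl
  have h := sphereUniform_prod_apply_eq_lintegral_rotatePair hn hD
  have hm : Measurable fun p => sphereUniform 2 1 {w | rotatePair w p ∈ C ×ˢ Cᶜ} :=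
    measurable_measure_prodMk_right (measurable_rotatePair hD)
  have h' := congrArg ENNReal.toReal h
  rw [Measure.prod_prod, ENNReal.toReal_mul, ← integral_toReal hm.aemeasurable
    (ae_of_all _ fun p => measure_lt_top _ _)] at h'
  change (sphereUniform n 1).real C * (sphereUniform n 1).real Cᶜ = _ at h'
  rw [probReal_compl_eq_one_sub hC] at h'
  rw [h']
  refine integral_mono_ae ?_ ?_ ?_
  · exact Integrable.of_bound hm.ennreal_toReal.aestronglyMeasurable 1
      (ae_of_all _ fun p => by
        rw [Real.norm_of_nonneg ENNReal.toReal_nonneg]; exact measureReal_le_one)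
  · have hf := measurable_frameCircleFrac hC
    refine Integrable.of_bound (hf.min (measurable_const.sub hf)).aestronglyMeasurable 1
      (ae_of_all _ fun p => ?_)
    have h0 : 0 ≤ frameCircleFrac C p := measureReal_nonneg
    have h1 : frameCircleFrac C p ≤ 1 := measureReal_le_one
    rw [Real.norm_of_nonneg (le_min h0 (by linarith))]
    exact (min_le_left _ _).trans h1
  · filter_upwards [ae_isUnitPair hn] with p hp
    refine le_min (measureReal_mono fun w hw => hw.1) ?_
    rw [← frameCircleFrac_compl hC, frameCircleFrac]
    have hrot := sphereUniform_map_linearIsometryEquiv 2 1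
      (planeRotation (frameCoord p) hp.norm_frameCoord)
    have hrm := (planeRotation (frameCoord p) hp.norm_frameCoord).continuous.measurable
    have heq : (sphereUniform 2 1).real (frameMap p ⁻¹' Cᶜ) =
        (sphereUniform 2 1).real (planeRotation (frameCoord p) hp.norm_frameCoord ⁻¹'
          (frameMap p ⁻¹' Cᶜ)) := by
      conv_lhs => rw [← hrot]
      exact map_measureReal_apply hrm (measurable_frameMap_right p hC.compl)
    rw [heq]
    exact measureReal_mono fun w hw => hw.2

/-- On linearly independent pairs of unit vectors, the circle fraction of the span can be computed
in the Gram-Schmidt frame. -/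
lemma subspaceCircleFrac_span_eq (hC : MeasurableSet C)
    {p : EuclideanSpace ℝ (Fin n) × EuclideanSpace ℝ (Fin n)} (hp : IsUnitPair p) :
    subspaceCircleFrac n (Submodule.span ℝ {p.1, p.2}) 1
      (C ∩ (Submodule.span ℝ {p.1, p.2} : Set (EuclideanSpace ℝ (Fin n)))) =
        frameCircleFrac C p := by
  have hex : ∃ φ : EuclideanSpace ℝ (Fin 2) →ₗᵢ[ℝ] EuclideanSpace ℝ (Fin n),
      LinearMap.range φ.toLinearMap = Submodule.span ℝ {p.1, p.2} :=
    ⟨hp.isometry, hp.range_isometry⟩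
  rw [subspaceCircleFrac, dif_pos hex]
  obtain ⟨φ, hφ, hφr⟩ : ∃ φ, φ = hex.choose ∧
      LinearMap.range φ.toLinearMap = Submodule.span ℝ {p.1, p.2} := ⟨_, rfl, hex.choose_spec⟩
  rw [← hφ, ← hφr]
  have hrange : LinearMap.range φ.toLinearMap = LinearMap.range hp.isometry.toLinearMap :=
    hφr.trans hp.range_isometry.symm
  let ρ : EuclideanSpace ℝ (Fin 2) ≃ₗᵢ[ℝ] EuclideanSpace ℝ (Fin 2) :=
    φ.equivRange.trans ((LinearIsometryEquiv.ofEq _ _ hrange).trans hp.isometry.equivRange.symm)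
  have hρ (w) : frameMap p (ρ w) = φ w := by
    have h : hp.isometry.equivRange (ρ w) =
        LinearIsometryEquiv.ofEq _ _ hrange (φ.equivRange w) := by simp [ρ]
    exact congrArg Subtype.val h
  have hφm : Measurable φ := φ.continuous.measurable
  have hρm : Measurable ρ := ρ.continuous.measurable
  rw [Measure.map_apply hφm (hC.inter (Submodule.closed_of_finiteDimensional _).measurableSet)]
  have hpre : φ ⁻¹' (C ∩ (LinearMap.range φ.toLinearMap : Set (EuclideanSpace ℝ (Fin n)))) =
      ρ ⁻¹' (frameMap p ⁻¹' C) := by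
    ext w
    simp [hρ]
  rw [hpre, ← Measure.map_apply hρm (measurable_frameMap_right p hC),
    sphereUniform_map_linearIsometryEquiv]
  rfl

end Invariance

/-- If a `[0, 1]`-valued random variable `Z` of mean `m` satisfies
`m * (1 - m) ≤ 𝔼 (min Z (1 - Z))`, then it is not concentrated near `0` and `1`. -/
lemma half_le_measureReal_mem_Icc {Ω : Type*} [MeasurableSpace Ω] {P : Measure Ω}
    [IsProbabilityMeasure P] {Z : Ω → ℝ} (hZ : Measurable Z) (h0 : ∀ ω, 0 ≤ Z ω)
    (h1 : ∀ ω, Z ω ≤ 1) {β : ℝ} (hβ : 0 < β) (hβm : β ≤ ∫ ω, Z ω ∂P)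
    (hm : ∫ ω, Z ω ∂P ≤ 1 / 2)
    (hmin : (∫ ω, Z ω ∂P) * (1 - ∫ ω, Z ω ∂P) ≤ ∫ ω, min (Z ω) (1 - Z ω) ∂P) :
    β / 2 ≤ P.real {ω | Z ω ∈ Set.Icc (β / 4) (9 / 10)} := by
  set m := ∫ ω, Z ω ∂P
  set S := {ω | Z ω ∈ Set.Icc (β / 4) (9 / 10)}
  have hS : MeasurableSet S := hZ measurableSet_Icc
  have hZi : Integrable Z P := Integrable.of_bound hZ.aestronglyMeasurable 1
    (ae_of_all _ fun ω => by rw [Real.norm_of_nonneg (h0 ω)]; exact h1 ω)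
  have hSi : Integrable (S.indicator fun _ => (1 : ℝ)) P := (integrable_const 1).indicator hS
  have hle : ∫ ω, (9 / 10 - β / 4) * min (Z ω) (1 - Z ω) ∂P ≤
      ∫ ω, (4 / 5 * (β / 4) + (1 / 10 - β / 4) * Z ω
        + (2 / 5 - 4 / 5 * (β / 4)) * S.indicator (fun _ => (1 : ℝ)) ω) ∂P := by
    refine integral_mono ((hZi.inf ((integrable_const 1).sub hZi)).const_mul _)
      (((integrable_const _).add (hZi.const_mul _)).add (hSi.const_mul _)) fun ω => ?_
    have h0' := h0 ω
    have h1' := h1 ω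
    have ha : (9 / 10 - β / 4) * min (Z ω) (1 - Z ω) ≤ (9 / 10 - β / 4) * Z ω :=
      mul_le_mul_of_nonneg_left (min_le_left _ _) (by linarith)
    have hb : (9 / 10 - β / 4) * min (Z ω) (1 - Z ω) ≤ (9 / 10 - β / 4) * (1 - Z ω) :=
      mul_le_mul_of_nonneg_left (min_le_right _ _) (by linarith)
    by_cases hω : ω ∈ S
    · simp only [Set.indicator_of_mem hω]
      rcases le_total (Z ω) (1 / 2) with h | h
      · linarith
      · nlinarith
    · simp only [Set.indicator_of_notMem hω]
      rcases lt_or_ge (Z ω) (β / 4) with h | h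
      · linarith
      · have : 9 / 10 < Z ω := by
          by_contra hcon
          exact hω ⟨h, not_lt.mp hcon⟩
        nlinarith
  have hsum : ∫ ω, (4 / 5 * (β / 4) + (1 / 10 - β / 4) * Z ω
        + (2 / 5 - 4 / 5 * (β / 4)) * S.indicator (fun _ => (1 : ℝ)) ω) ∂P =
      4 / 5 * (β / 4) + (1 / 10 - β / 4) * m + (2 / 5 - 4 / 5 * (β / 4)) * P.real S := by
    have hind : ∫ ω, S.indicator (fun _ => (1 : ℝ)) ω ∂P = P.real S := integral_indicator_one hS
    have hadd : Integrable (fun ω => 4 / 5 * (β / 4) + (1 / 10 - β / 4) * Z ω) P :=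
      (integrable_const _).add (hZi.const_mul _)
    rw [integral_add hadd (hSi.const_mul _), integral_add (integrable_const _) (hZi.const_mul _),
      integral_const_mul _ Z, integral_const_mul _ (S.indicator _), hind]
    simp [m]
  rw [hsum, integral_const_mul] at hle
  by_contra hcon
  rw [not_le] at hcon
  have hS' : (2 / 5 - 4 / 5 * (β / 4)) * P.real S < (2 / 5 - 4 / 5 * (β / 4)) * (β / 2) :=
    mul_lt_mul_of_pos_left hcon (by linarith)
  have hlow : (9 / 10 - β / 4) * (m * (1 - m)) ≤
      (9 / 10 - β / 4) * ∫ ω, min (Z ω) (1 - Z ω) ∂P :=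
    mul_le_mul_of_nonneg_left hmin (by linarith)
  have hmono : 0 ≤ (m / 4 - β / 4) * (8 / 5 - 8 / 5 * (m / 4 + β / 4) - m ^ 2) :=
    mul_nonneg (by linarith) (by nlinarith)
  have hpos : 0 ≤ m * (2 / 5 - 4 / 5 * m + 1 / 4 * m ^ 2) :=
    mul_nonneg (by linarith) (by nlinarith)
  nlinarith

lemma ofReal_half_le_frameCircleFrac_mem_Icc {n : ℕ} (hn : 2 ≤ n)
    {C : Set (EuclideanSpace ℝ (Fin n))} (hC : MeasurableSet C) {β : ℝ} (hβ : 0 < β)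
    (hβC : β ≤ (sphereUniform n 1).real C) (hC2 : (sphereUniform n 1).real C ≤ 1 / 2) :
    ENNReal.ofReal (β / 2) ≤ ((sphereUniform n 1).prod (sphereUniform n 1))
      {p | frameCircleFrac C p ∈ Set.Icc (β / 4) (9 / 10)} := by
  refine ENNReal.ofReal_le_of_le_toReal (half_le_measureReal_mem_Icc
    (measurable_frameCircleFrac hC) (fun _ => measureReal_nonneg) (fun _ => measureReal_le_one)
    hβ ?_ ?_ ?_)
  all_goals rw [integral_frameCircleFrac hn hC]
  exacts [hβC, hC2, real_mul_one_sub_le_integral_min hn hC]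

/-- Variant of Raz's lemma: for `C ⊆ S^{n-1}` of fractional measure in `[β,1/2]`
(resp. `[1/2,1-β]`), the density of `C` in the unit circle of the span of two
independent uniform random points of `S^{n-1}` lies in `[β/4, 9/10]`
(resp. `[1/10, 1-β/4]`) with probability at least `β/2`. -/
theorem raz_variant :
    ∀ (n : ℕ), 2 ≤ n →
      ∀ (C : Set (EuclideanSpace ℝ (Fin n))),
        C ⊆ Metric.sphere (0 : EuclideanSpace ℝ (Fin n)) 1 →
        MeasurableSet C →
        ∀ β : ℝ, 0 < β → β ≤ 1 / 2 →
          ((sphereUniform n 1 C).toReal ∈ Set.Icc β (1 / 2) →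
            ENNReal.ofReal (β / 2) ≤
              ((sphereUniform n 1).prod (sphereUniform n 1))
                {p : EuclideanSpace ℝ (Fin n) × EuclideanSpace ℝ (Fin n) |
                  subspaceCircleFrac n (Submodule.span ℝ {p.1, p.2}) 1
                      (C ∩ (Submodule.span ℝ {p.1, p.2} : Set (EuclideanSpace ℝ (Fin n))))
                    ∈ Set.Icc (β / 4) (9 / 10)}) ∧
          ((sphereUniform n 1 C).toReal ∈ Set.Icc (1 / 2) (1 - β) →
            ENNReal.ofReal (β / 2) ≤
              ((sphereUniform n 1).prod (sphereUniform n 1))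
                {p : EuclideanSpace ℝ (Fin n) × EuclideanSpace ℝ (Fin n) |
                  subspaceCircleFrac n (Submodule.span ℝ {p.1, p.2}) 1
                      (C ∩ (Submodule.span ℝ {p.1, p.2} : Set (EuclideanSpace ℝ (Fin n))))
                    ∈ Set.Icc (1 / 10) (1 - β / 4)}) := by
  intro n hn C _ hC β hβ _
  have hcongr (I : Set ℝ) :
      ((sphereUniform n 1).prod (sphereUniform n 1))
        {p : EuclideanSpace ℝ (Fin n) × EuclideanSpace ℝ (Fin n) |
          subspaceCircleFrac n (Submodule.span ℝ {p.1, p.2}) 1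
            (C ∩ (Submodule.span ℝ {p.1, p.2} : Set (EuclideanSpace ℝ (Fin n)))) ∈ I} =
        ((sphereUniform n 1).prod (sphereUniform n 1)) {p | frameCircleFrac C p ∈ I} := by
    refine measure_congr ?_
    filter_upwards [ae_isUnitPair hn] with p hp
    exact congrArg (· ∈ I) (subspaceCircleFrac_span_eq hC hp)
  rw [hcongr, hcongr]
  refine ⟨fun h => ofReal_half_le_frameCircleFrac_mem_Icc hn hC hβ h.1 h.2, fun h => ?_⟩
  have hreal := probReal_compl_eq_one_sub (μ := sphereUniform n 1) hC
  have h1 : 1 / 2 ≤ (sphereUniform n 1).real C := h.1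
  have h2 : (sphereUniform n 1).real C ≤ 1 - β := h.2
  refine (ofReal_half_le_frameCircleFrac_mem_Icc hn hC.compl hβ (by linarith)
    (by linarith)).trans (measure_mono fun p hp => ?_)
  rw [Set.mem_ofPred_eq, frameCircleFrac_compl hC] at hp
  exact ⟨by linarith [hp.2], by linarith [hp.1]⟩
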